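/- arXiv:2509.16258 — 2 statements merged into one kernel-verified Lean document; each statement's English description precedes it below -/
import Mathlib

section
/- Let H be a finite-dimensional complex inner product space and ψ, φ ∈ H with ⟪ψ, φ⟫ ≠ 0. Let P : Fin n → (H →L[ℂ] H) be a family of self-adjoint idempotent continuous linear maps that pairwise commute, such that every P i satisfies at least one of: P i ψ = ψ, P i ψ = 0, P i φ = φ, P i φ = 0. For s : Fin n → Bool define Q_s = ∏_{i} (if s i then P i else id − P i). Then for every sign pattern s, either ⟪ψ, Q_s φ⟫ = 0 or ⟪ψ, Q_s φ⟫ = ⟪ψ, φ⟫; equivalently, f(Q_s) = ⟪ψ, Q_s φ⟫ / ⟪ψ, φ⟫ ∈ {0, 1}. -/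
open scoped InnerProductSpace

/-- A product of pairwise commuting symmetric operators, each of which fixes or annihilates
`ψ` or `φ`, has matrix element `0` or `⟪ψ, φ⟫` between `ψ` and `φ`. -/
theorem inner_list_prod_apply_eq_zero_or_eq {𝕜 E : Type*} [RCLike 𝕜] [NormedAddCommGroup E]
    [InnerProductSpace 𝕜 E] (ψ φ : E) (l : List (E →L[𝕜] E))
    (hsymm : ∀ A ∈ l, ∀ x y, ⟪A x, y⟫_𝕜 = ⟪x, A y⟫_𝕜)
    (hcomm : ∀ A ∈ l, ∀ B ∈ l, Commute A B)
    (h : ∀ A ∈ l, A ψ = ψ ∨ A ψ = 0 ∨ A φ = φ ∨ A φ = 0) :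
    ⟪ψ, l.prod φ⟫_𝕜 = 0 ∨ ⟪ψ, l.prod φ⟫_𝕜 = ⟪ψ, φ⟫_𝕜 := by
  induction l with
  | nil => simp
  | cons A l ih =>
    have ih := ih (fun B hB => hsymm B (List.mem_cons_of_mem A hB))
      (fun B hB C hC => hcomm B (List.mem_cons_of_mem A hB) C (List.mem_cons_of_mem A hC))
      (fun B hB => h B (List.mem_cons_of_mem A hB))
    have hA : A ∈ A :: l := List.mem_cons_self
    have hprod : Commute A l.prod :=
      Commute.list_prod_right _ _ fun B hB => hcomm A hA B (List.mem_cons_of_mem A hB)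
    have hleft : ⟪ψ, (A :: l).prod φ⟫_𝕜 = ⟪A ψ, l.prod φ⟫_𝕜 := by
      rw [List.prod_cons, mul_apply_eq_comp, hsymm A hA]
    have hright : ⟪ψ, (A :: l).prod φ⟫_𝕜 = ⟪ψ, l.prod (A φ)⟫_𝕜 := by
      rw [List.prod_cons, hprod.eq, mul_apply_eq_comp]
    rcases h A hA with h | h | h | h
    · rwa [hleft, h]
    · left; rw [hleft, h, inner_zero_left]
    · rwa [hright, h]
    · left; rw [hright, h, map_zero, inner_zero_right]

/-- if every projector `P i` (of a pairwise commuting family)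
fixes or annihilates `ψ`, or fixes or annihilates `φ` (i.e. forms no
non-commutation chain with `P_ψ` and `P_φ`), then for every sign pattern `s`
the product `Q_s = ∏ i, (if s i then P i else id - P i)` satisfies
`⟪ψ, Q_s φ⟫ = 0` or `⟪ψ, Q_s φ⟫ = ⟪ψ, φ⟫`; equivalently the candidate ABL
probability `f(Q_s) = ⟪ψ, Q_s φ⟫ / ⟪ψ, φ⟫` is `0` or `1`. -/
theorem stmt12 {H : Type*} [NormedAddCommGroup H] [InnerProductSpace ℂ H]
    [FiniteDimensional ℂ H] (ψ φ : H) (hne : ⟪ψ, φ⟫_ℂ ≠ 0)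
    {n : ℕ} (P : Fin n → H →L[ℂ] H)
    (hsa : ∀ i, IsSelfAdjoint (P i))
    (hidem : ∀ i, P i ∘L P i = P i)
    (hcomm : ∀ i j, Commute (P i) (P j))
    (hchain : ∀ i, P i ψ = ψ ∨ P i ψ = 0 ∨ P i φ = φ ∨ P i φ = 0)
    (Q : (Fin n → Bool) → H →L[ℂ] H)
    (hQ : ∀ s, Q s =
      (List.ofFn fun i => if s i then P i else ContinuousLinearMap.id ℂ H - P i).prod) :
    ∀ s : Fin n → Bool,
      ⟪ψ, Q s φ⟫_ℂ = 0 ∨ ⟪ψ, Q s φ⟫_ℂ = ⟪ψ, φ⟫_ℂ := by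
  intro s
  rw [hQ s]
  apply inner_list_prod_apply_eq_zero_or_eq
  · refine List.forall_mem_ofFn_iff.2 fun i x y => ?_
    have hP : ⟪P i x, y⟫_ℂ = ⟪x, P i y⟫_ℂ := (hsa i).isSymmetric x y
    cases s i <;> simp [inner_sub_left, inner_sub_right, hP]
  · refine List.forall_mem_ofFn_iff.2 fun i => List.forall_mem_ofFn_iff.2 fun j => ?_
    have hid (A : H →L[ℂ] H) : Commute (ContinuousLinearMap.id ℂ H) A := Commute.one_left A
    have hij := hcomm i j
    split_ifs
    · exact hij
    · exact (hid _).symm.sub_right hij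
    · exact (hid _).sub_left hij
    · exact ((hid _).sub_right (hid _)).sub_left ((hid _).symm.sub_right hij)
  · refine List.forall_mem_ofFn_iff.2 fun i => ?_
    rcases hchain i with h | h | h | h <;> cases s i <;> simp [h]
end

section
/- Let H be a finite-dimensional complex inner product space and ψ, φ ∈ H with ⟪ψ, φ⟫ ≠ 0. Let P : Fin n → (H →L[ℂ] H) be a family of self-adjoint idempotent continuous linear maps that pairwise commute, such that every P i satisfies at least one of: P i ψ = ψ, P i ψ = 0, P i φ = φ, P i φ = 0. For s : Fin n → Bool define Q_s = ∏_{i} (if s i then P i else id − P i). Then there exists exactly one sign pattern s : Fin n → Bool with ⟪ψ, Q_s φ⟫ ≠ 0, and for this unique s one has ⟪ψ, Q_s φ⟫ = ⟪ψ, φ⟫. -/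
open scoped InnerProductSpace

/-- If each of a commuting family of self-adjoint operators has `ψ` or `φ` as an eigenvector with
real eigenvalue `c i`, then the matrix element of a product between `ψ` and `φ` is the product of
these eigenvalues times `⟪ψ, φ⟫`. -/
theorem inner_list_prod_apply_of_eigenvector {H ι : Type*} [NormedAddCommGroup H]
    [InnerProductSpace ℂ H] [CompleteSpace H] (ψ φ : H) (R : ι → H →L[ℂ] H) (c : ι → ℝ)
    (hsa : ∀ i, IsSelfAdjoint (R i)) (hcomm : ∀ i j, Commute (R i) (R j))
    (heig : ∀ i, R i ψ = (c i : ℂ) • ψ ∨ R i φ = (c i : ℂ) • φ) (l : List ι) :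
    ⟪ψ, (l.map R).prod φ⟫_ℂ = (l.map c).prod * ⟪ψ, φ⟫_ℂ := by
  induction l with
  | nil => simp
  | cons i l ih =>
    have hA : Commute (R i) (l.map R).prod := by
      refine Commute.list_prod_right _ _ fun x hx => ?_
      obtain ⟨j, -, rfl⟩ := List.mem_map.1 hx
      exact hcomm i j
    simp only [List.map_cons, List.prod_cons, Complex.ofReal_mul, mul_assoc, ← ih]
    rcases heig i with h | h
    · have hsymm := (hsa i).isSymmetric ψ ((l.map R).prod φ)
      simp only [ContinuousLinearMap.coe_coe] at hsymm
      rw [mul_apply_eq_comp, ← hsymm, h, inner_smul_left, Complex.conj_ofReal]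
    · rw [hA.eq, mul_apply_eq_comp, h, map_smul, inner_smul_right]

/-- the key uniqueness claim of the main theorem: under the
no-non-commutation-chain hypothesis, there is exactly one sign pattern `s`
with `⟪ψ, Q_s φ⟫ ≠ 0`, and for this unique `s` one has
`⟪ψ, Q_s φ⟫ = ⟪ψ, φ⟫`. -/
theorem stmt13 {H : Type*} [NormedAddCommGroup H] [InnerProductSpace ℂ H]
    [FiniteDimensional ℂ H] (ψ φ : H) (hne : ⟪ψ, φ⟫_ℂ ≠ 0)
    {n : ℕ} (P : Fin n → H →L[ℂ] H)
    (hsa : ∀ i, IsSelfAdjoint (P i))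
    (hidem : ∀ i, P i ∘L P i = P i)
    (hcomm : ∀ i j, Commute (P i) (P j))
    (hchain : ∀ i, P i ψ = ψ ∨ P i ψ = 0 ∨ P i φ = φ ∨ P i φ = 0)
    (Q : (Fin n → Bool) → H →L[ℂ] H)
    (hQ : ∀ s, Q s =
      (List.ofFn fun i => if s i then P i else ContinuousLinearMap.id ℂ H - P i).prod) :
    (∃! s : Fin n → Bool, ⟪ψ, Q s φ⟫_ℂ ≠ 0) ∧
      ∀ s : Fin n → Bool, ⟪ψ, Q s φ⟫_ℂ ≠ 0 → ⟪ψ, Q s φ⟫_ℂ = ⟪ψ, φ⟫_ℂ := by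
  classical
  set R : (Fin n → Bool) → Fin n → H →L[ℂ] H :=
    fun s i => if s i then P i else ContinuousLinearMap.id ℂ H - P i with hR
  have ht : ∀ i, ∃ b : Bool, P i ψ = (if b then ψ else 0) ∨ P i φ = (if b then φ else 0) := by
    intro i
    rcases hchain i with h | h | h | h
    exacts [⟨true, .inl h⟩, ⟨false, .inl h⟩, ⟨true, .inr h⟩, ⟨false, .inr h⟩]
  choose t ht using ht
  have hQt : ∀ s, ⟪ψ, Q s φ⟫_ℂ = if s = t then ⟪ψ, φ⟫_ℂ else 0 := by
    intro s
    have key := inner_list_prod_apply_of_eigenvector ψ φ (R s) (fun i => if s i = t i then 1 else 0)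
      (fun i => ?_) (fun i j => ?_) (fun i => ?_) (List.finRange n)
    · rw [hQ, List.ofFn_eq_map, key, ← List.ofFn_eq_map, List.prod_ofFn,
        Finset.prod_ite_zero, Finset.prod_const_one]
      simp only [Finset.mem_univ, true_imp_iff, funext_iff]
      split_ifs <;> simp
    · simp only [hR]
      split_ifs
      exacts [hsa i, (IsSelfAdjoint.one _).sub (hsa i)]
    · have hone (A : H →L[ℂ] H) : Commute (ContinuousLinearMap.id ℂ H) A := Commute.one_left A
      simp only [hR]
      split_ifs
      exacts [hcomm i j, (hone _).symm.sub_right (hcomm i j), (hone _).sub_left (hcomm i j),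
        (hone _).sub_left ((hone _).symm.sub_right (hcomm i j))]
    · refine (ht i).imp (fun h => ?_) (fun h => ?_) <;>
        cases hs : s i <;> cases hti : t i <;> simp_all
  simp only [hQt]
  refine ⟨⟨t, by simpa using hne, fun s hs => ?_⟩, fun s hs => ?_⟩
  · by_contra h
    simp [h] at hs
  · by_contra h
    simp_all
end
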